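/- arXiv:2301.13378 — 2 statements merged into one kernel-verified Lean document; each statement's English description precedes it below -/
import Mathlib

section
/- For H ∈ [0,1], det Σ_3(H) = 1 + 2 ρ_1(H)² ρ_2(H) − ρ_2(H)² − 2 ρ_1(H)²; as a function of H it is strictly increasing on [0, 1/2] from 1/2 (at H = 0) to 1 (at H = 1/2) and strictly decreasing on [1/2, 1] from 1 to 0 (at H = 1). Consequently log det Σ_3(H) increases from −log 2 to 0 on [0,1/2] and decreases from 0 to −∞ on [1/2,1]. -/
open Real Matrix Filter Topology

/-- `ρ_1(H) = 2^{2H−1} − 1`. -/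
noncomputable def fgnRho1 (H : ℝ) : ℝ := (2 : ℝ) ^ (2 * H - 1) - 1

/-- `ρ_2(H) = (3^{2H} − 2^{2H+1} + 1)/2`. -/
noncomputable def fgnRho2 (H : ℝ) : ℝ :=
  ((3 : ℝ) ^ (2 * H) - (2 : ℝ) ^ (2 * H + 1) + 1) / 2

/-- The 3×3 covariance matrix `Σ_3(H)` of fractional Gaussian noise. -/
noncomputable def fgnCov3 (H : ℝ) : Matrix (Fin 3) (Fin 3) ℝ :=
  !![1, fgnRho1 H, fgnRho2 H;
     fgnRho1 H, 1, fgnRho1 H;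
     fgnRho2 H, fgnRho1 H, 1]

theorem four_rpow_half : (4 : ℝ) ^ (1 / 2 : ℝ) = 2 := by
  rw [← Real.sqrt_eq_rpow, show (4 : ℝ) = 2 ^ 2 by norm_num]
  exact Real.sqrt_sq (by norm_num)

theorem nine_rpow_half : (9 : ℝ) ^ (1 / 2 : ℝ) = 3 := by
  rw [← Real.sqrt_eq_rpow, show (9 : ℝ) = 3 ^ 2 by norm_num]
  exact Real.sqrt_sq (by norm_num)

theorem fgnRho1_eq (H : ℝ) : fgnRho1 H = 4 ^ H / 2 - 1 := by
  rw [fgnRho1, Real.rpow_sub (by norm_num), Real.rpow_mul (by norm_num)]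
  norm_num

theorem fgnRho2_eq (H : ℝ) : fgnRho2 H = (9 ^ H - 2 * 4 ^ H + 1) / 2 := by
  rw [fgnRho2, Real.rpow_add (by norm_num), Real.rpow_mul (by norm_num),
    Real.rpow_mul (by norm_num)]
  norm_num [mul_comm]

theorem det_fgnCov3 (H : ℝ) : (fgnCov3 H).det =
    1 + 2 * fgnRho1 H ^ 2 * fgnRho2 H - fgnRho2 H ^ 2 - 2 * fgnRho1 H ^ 2 := by
  simp [fgnCov3, Matrix.det_fin_three]
  ring

theorem det_fgnCov3_eq (H : ℝ) : (fgnCov3 H).det =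
    (1 - 9 ^ H + 2 * 4 ^ H) * (9 ^ H + 2 * 4 ^ H - (4 ^ H) ^ 2 - 1) / 4 := by
  rw [det_fgnCov3, fgnRho1_eq, fgnRho2_eq]
  ring

theorem hasDerivAt_det_fgnCov3 (H : ℝ) :
    HasDerivAt (fun H : ℝ => (fgnCov3 H).det)
      ((((4 ^ H) ^ 2 + 2 - 2 * 9 ^ H) * (9 ^ H * Real.log 9 - 2 * (4 ^ H * Real.log 4)) +
        2 * (2 - 4 ^ H) * (1 - 9 ^ H + 2 * 4 ^ H) * (4 ^ H * Real.log 4)) / 4) H := by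
  simp only [det_fgnCov3_eq]
  have h4 : HasDerivAt (fun H : ℝ => (4 : ℝ) ^ H) (4 ^ H * Real.log 4) H :=
    (Real.hasStrictDerivAt_const_rpow (by norm_num) H).hasDerivAt
  have h9 : HasDerivAt (fun H : ℝ => (9 : ℝ) ^ H) (9 ^ H * Real.log 9) H :=
    (Real.hasStrictDerivAt_const_rpow (by norm_num) H).hasDerivAt
  refine (((((h9.const_sub 1).add (h4.const_mul 2)).mul
    (((h9.add (h4.const_mul 2)).sub (h4.pow 2)).sub_const 1)).div_const 4)).congr_deriv ?_
  simp
  ring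

theorem continuous_det_fgnCov3 : Continuous (fun H : ℝ => (fgnCov3 H).det) :=
  continuous_iff_continuousAt.2 fun H => (hasDerivAt_det_fgnCov3 H).continuousAt

theorem convexOn_rpow_sixteen_ninths_add :
    ConvexOn ℝ Set.univ (fun H : ℝ => (16 / 9 : ℝ) ^ H + 2 * (1 / 9 : ℝ) ^ H) :=
  (convexOn_rpow_left (by norm_num)).add
    ((convexOn_rpow_left (by norm_num)).smul (by norm_num : (0 : ℝ) ≤ 2))

theorem rpow_sixteen_ninths_add_mul (H : ℝ) :
    ((16 / 9 : ℝ) ^ H + 2 * (1 / 9 : ℝ) ^ H) * 9 ^ H = (4 ^ H) ^ 2 + 2 := by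
  have h : (0 : ℝ) < 9 ^ H := by positivity
  rw [Real.div_rpow (by norm_num) (by norm_num), Real.div_rpow (by norm_num) (by norm_num),
    show (16 : ℝ) = 4 * 4 by norm_num, Real.mul_rpow (by norm_num) (by norm_num), Real.one_rpow]
  field_simp

theorem rpow_sixteen_ninths_add_half :
    (16 / 9 : ℝ) ^ (1 / 2 : ℝ) + 2 * (1 / 9 : ℝ) ^ (1 / 2 : ℝ) = 2 := by
  have h := rpow_sixteen_ninths_add_mul (1 / 2)
  rw [four_rpow_half, nine_rpow_half] at h
  linarith

theorem four_rpow_sq_add_two_le {H : ℝ} (h₀ : 1 / 2 ≤ H) (h₁ : H ≤ 1) :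
    ((4 : ℝ) ^ H) ^ 2 + 2 ≤ 2 * 9 ^ H := by
  have h := convexOn_rpow_sixteen_ninths_add.le_max_of_mem_Icc (Set.mem_univ (1 / 2))
    (Set.mem_univ 1) ⟨h₀, h₁⟩
  simp only [rpow_sixteen_ninths_add_half] at h
  norm_num at h
  rw [← rpow_sixteen_ninths_add_mul]
  gcongr

theorem le_four_rpow_sq_add_two {H : ℝ} (h : H < 1 / 2) :
    2 * 9 ^ H ≤ ((4 : ℝ) ^ H) ^ 2 + 2 := by
  rw [← rpow_sixteen_ninths_add_mul]
  gcongr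
  by_contra! hlt
  have hseg : (1 / 2 : ℝ) ∈ openSegment ℝ H 1 := by
    rw [openSegment_eq_Ioo (by linarith)]
    exact ⟨h, by norm_num⟩
  have hright := convexOn_rpow_sixteen_ninths_add.lt_right_of_left_lt (Set.mem_univ H)
    (Set.mem_univ 1) hseg (by simpa only [rpow_sixteen_ninths_add_half] using hlt)
  simp only [rpow_sixteen_ninths_add_half] at hright
  norm_num at hright

theorem three_mul_sq_four_rpow_le {H : ℝ} (h : H ≤ 1 / 2) :
    3 * ((4 : ℝ) ^ H) ^ 2 ≤ 4 * 9 ^ H := by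
  have h1 : (9 / 16 : ℝ) ^ (1 / 2 : ℝ) ≤ (9 / 16 : ℝ) ^ H :=
    Real.rpow_le_rpow_of_exponent_ge (by norm_num) (by norm_num) h
  rw [show (16 : ℝ) = 4 * 4 by norm_num, Real.div_rpow (by norm_num) (by norm_num),
    Real.div_rpow (by norm_num) (by norm_num), Real.mul_rpow (by norm_num) (by norm_num),
    Real.mul_rpow (by norm_num) (by norm_num), four_rpow_half, nine_rpow_half,
    div_le_div_iff₀ (by norm_num) (by positivity)] at h1
  linarith

theorem two_mul_nine_rpow_le {H : ℝ} (h : H ≤ 1 / 2) : 2 * (9 : ℝ) ^ H ≤ 3 * 4 ^ H := by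
  have h1 : (9 / 4 : ℝ) ^ H ≤ (9 / 4 : ℝ) ^ (1 / 2 : ℝ) :=
    Real.rpow_le_rpow_of_exponent_le (by norm_num) h
  rw [Real.div_rpow (by norm_num) (by norm_num), Real.div_rpow (by norm_num) (by norm_num),
    four_rpow_half, nine_rpow_half, div_le_div_iff₀ (by positivity) (by norm_num)] at h1
  linarith

theorem le_two_mul_nine_rpow {H : ℝ} (h : 1 / 2 ≤ H) : 3 * (4 : ℝ) ^ H ≤ 2 * 9 ^ H := by
  have h1 : (9 / 4 : ℝ) ^ (1 / 2 : ℝ) ≤ (9 / 4 : ℝ) ^ H :=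
    Real.rpow_le_rpow_of_exponent_le (by norm_num) h
  rw [Real.div_rpow (by norm_num) (by norm_num), Real.div_rpow (by norm_num) (by norm_num),
    four_rpow_half, nine_rpow_half, div_le_div_iff₀ (by norm_num) (by positivity)] at h1
  linarith

theorem nine_rpow_lt {H : ℝ} (h : H < 1) : (9 : ℝ) ^ H < 1 + 2 * 4 ^ H := by
  have h1 : (4 / 9 : ℝ) ^ (1 : ℝ) < (4 / 9 : ℝ) ^ H :=
    Real.rpow_lt_rpow_of_exponent_gt (by norm_num) (by norm_num) h
  have h2 : (1 / 9 : ℝ) ^ (1 : ℝ) < (1 / 9 : ℝ) ^ H :=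
    Real.rpow_lt_rpow_of_exponent_gt (by norm_num) (by norm_num) h
  rw [Real.rpow_one, Real.div_rpow (by norm_num) (by norm_num),
    div_lt_div_iff₀ (by norm_num) (by positivity)] at h1 h2
  rw [Real.one_rpow] at h2
  linarith

theorem strictMonoOn_det_fgnCov3 :
    StrictMonoOn (fun H : ℝ => (fgnCov3 H).det) (Set.Icc 0 (1 / 2)) := by
  refine strictMonoOn_of_deriv_pos (convex_Icc _ _) continuous_det_fgnCov3.continuousOn ?_
  intro H hH
  rw [interior_Icc] at hH
  obtain ⟨h0, h1⟩ := hH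
  rw [(hasDerivAt_det_fgnCov3 H).deriv]
  have hp1 : (1 : ℝ) < 4 ^ H := Real.one_lt_rpow (by norm_num) h0
  have hp2 : (4 : ℝ) ^ H < 2 := by
    rw [← four_rpow_half]
    exact Real.rpow_lt_rpow_of_exponent_lt (by norm_num) h1
  have hpq : (4 : ℝ) ^ H ≤ 9 ^ H := Real.rpow_le_rpow (by norm_num) (by norm_num) h0.le
  have hE := le_four_rpow_sq_add_two h1
  have hE' := three_mul_sq_four_rpow_le h1.le
  have hq := two_mul_nine_rpow_le h1.le
  have hA : 0 < Real.log 4 := Real.log_pos (by norm_num)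
  have hB : 0 < Real.log 9 := Real.log_pos (by norm_num)
  have hAB : Real.log 4 ≤ Real.log 9 := Real.log_le_log (by norm_num) (by norm_num)
  generalize (4 : ℝ) ^ H = p at *
  generalize (9 : ℝ) ^ H = q at *
  generalize Real.log 4 = A at *
  generalize Real.log 9 = B at *
  have hpA : 0 < p * A := by positivity
  have hqB : p * A ≤ q * B := mul_le_mul hpq hAB hA.le (by linarith)
  have h2 : 2 * (p ^ 2 + 2 - 2 * q) ≤ 4 * (2 - p) := by nlinarith
  have h3 : 0 ≤ (p ^ 2 + 2 - 2 * q) * (q * B - p * A) :=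
    mul_nonneg (by linarith) (by linarith)
  have h4 : p ^ 2 + 2 - 2 * q < 2 * (2 - p) * (1 - q + 2 * p) := by
    nlinarith [mul_pos (sub_pos.2 hp2) (show 0 < 1 - q + 2 * p - 1 by linarith)]
  nlinarith [mul_lt_mul_of_pos_right h4 hpA]

theorem strictAntiOn_det_fgnCov3 :
    StrictAntiOn (fun H : ℝ => (fgnCov3 H).det) (Set.Icc (1 / 2) 1) := by
  refine strictAntiOn_of_deriv_neg (convex_Icc _ _) continuous_det_fgnCov3.continuousOn ?_
  intro H hH
  rw [interior_Icc] at hH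
  obtain ⟨h0, h1⟩ := hH
  rw [(hasDerivAt_det_fgnCov3 H).deriv]
  have hp2 : 2 < (4 : ℝ) ^ H := by
    rw [← four_rpow_half]
    exact Real.rpow_lt_rpow_of_exponent_lt (by norm_num) h0
  have hE := four_rpow_sq_add_two_le h0.le h1.le
  have hpq := le_two_mul_nine_rpow h0.le
  have hq := nine_rpow_lt h1
  have hA : 0 < Real.log 4 := Real.log_pos (by norm_num)
  have hAB : 4 * Real.log 4 ≤ 3 * Real.log 9 := by
    have h : Real.log (4 ^ 4) ≤ Real.log (9 ^ 3) := Real.log_le_log (by norm_num) (by norm_num)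
    simpa only [Real.log_pow, Nat.cast_ofNat] using h
  generalize (4 : ℝ) ^ H = p at *
  generalize (9 : ℝ) ^ H = q at *
  generalize Real.log 4 = A at *
  generalize Real.log 9 = B at *
  have hqB : 0 ≤ q * B - 2 * (p * A) := by
    nlinarith [mul_le_mul hpq hAB (by linarith) (by linarith)]
  have h2 := mul_nonneg (sub_nonneg.2 hE) hqB
  have h3 : 0 < (p - 2) * (1 - q + 2 * p) * (p * A) :=
    mul_pos (mul_pos (by linarith) (by linarith)) (mul_pos (by linarith) hA)
  linarith

theorem det_fgnCov3_zero : (fgnCov3 0).det = 1 / 2 := by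
  rw [det_fgnCov3_eq]
  norm_num

theorem det_fgnCov3_half : (fgnCov3 (1 / 2)).det = 1 := by
  rw [det_fgnCov3_eq, four_rpow_half, nine_rpow_half]
  norm_num

theorem det_fgnCov3_one : (fgnCov3 1).det = 0 := by
  rw [det_fgnCov3_eq]
  norm_num

theorem det_fgnCov3_pos {H : ℝ} (h₀ : 0 ≤ H) (h₁ : H < 1) : 0 < (fgnCov3 H).det := by
  rcases le_total H (1 / 2) with h | h
  · have := strictMonoOn_det_fgnCov3.monotoneOn ⟨le_rfl, by norm_num⟩ ⟨h₀, h⟩ h₀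
    simp only [det_fgnCov3_zero] at this
    linarith
  · have := strictAntiOn_det_fgnCov3 ⟨h, h₁.le⟩ ⟨by norm_num, le_rfl⟩ h₁
    simpa only [det_fgnCov3_one] using this

/-- `det Σ_3(H) = 1 + 2ρ_1²ρ_2 − ρ_2² − 2ρ_1²`; it strictly increases on `[0,1/2]`
from `1/2` to `1`, strictly decreases on `[1/2,1]` from `1` to `0`; hence
`log det Σ_3(H)` increases from `−log 2` to `0` on `[0,1/2]` and decreases from `0`
to `−∞` on `[1/2,1]`. -/
theorem fgn_det_cov3_monotonicity :
    (∀ H ∈ Set.Icc (0 : ℝ) 1,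
      (fgnCov3 H).det =
        1 + 2 * fgnRho1 H ^ 2 * fgnRho2 H - fgnRho2 H ^ 2 - 2 * fgnRho1 H ^ 2) ∧
    StrictMonoOn (fun H : ℝ => (fgnCov3 H).det) (Set.Icc 0 (1/2)) ∧
    StrictAntiOn (fun H : ℝ => (fgnCov3 H).det) (Set.Icc (1/2) 1) ∧
    (fgnCov3 0).det = 1/2 ∧ (fgnCov3 (1/2)).det = 1 ∧ (fgnCov3 1).det = 0 ∧
    StrictMonoOn (fun H : ℝ => Real.log (fgnCov3 H).det) (Set.Icc 0 (1/2)) ∧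
    StrictAntiOn (fun H : ℝ => Real.log (fgnCov3 H).det) (Set.Ico (1/2) 1) ∧
    Real.log (fgnCov3 0).det = -Real.log 2 ∧
    Real.log (fgnCov3 (1/2)).det = 0 ∧
    Filter.Tendsto (fun H : ℝ => Real.log (fgnCov3 H).det)
      (nhdsWithin 1 (Set.Iio 1)) Filter.atBot := by
  refine ⟨fun H _ => det_fgnCov3 H, strictMonoOn_det_fgnCov3, strictAntiOn_det_fgnCov3,
    det_fgnCov3_zero, det_fgnCov3_half, det_fgnCov3_one, ?_, ?_, ?_, ?_, ?_⟩
  · intro x hx y hy hxy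
    exact Real.log_lt_log (det_fgnCov3_pos hx.1 (by linarith [hx.2]))
      (strictMonoOn_det_fgnCov3 hx hy hxy)
  · intro x hx y hy hxy
    exact Real.log_lt_log (det_fgnCov3_pos (by linarith [hy.1]) hy.2)
      (strictAntiOn_det_fgnCov3 ⟨hx.1, hx.2.le⟩ ⟨hy.1, hy.2.le⟩ hxy)
  · rw [det_fgnCov3_zero, one_div, Real.log_inv]
  · rw [det_fgnCov3_half, Real.log_one]
  · refine Real.tendsto_log_nhdsGT_zero.comp (tendsto_nhdsWithin_iff.2 ⟨?_, ?_⟩)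
    · have h := continuous_det_fgnCov3.tendsto 1
      simp only [det_fgnCov3_one] at h
      exact h.mono_left nhdsWithin_le_nhds
    · filter_upwards [Ioo_mem_nhdsLT (show (0 : ℝ) < 1 by norm_num)] with H hH
      exact det_fgnCov3_pos hH.1.le hH.2
end

section
/- For all H ∈ (0,1), det Σ_2(H) ≥ det Σ_3(H), and more precisely det Σ_2(H) − det Σ_3(H) = (ρ_1(H) − ρ_2(H))² + 2 ρ_1(H) ρ_2(H) (1 − ρ_1(H)) ≥ 0, with equality only for H = 1/2. -/
open Real Matrix

/-- The 2×2 covariance matrix `Σ_2(H)` of fractional Gaussian noise. -/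
noncomputable def fgnCov2 (H : ℝ) : Matrix (Fin 2) (Fin 2) ℝ :=
  !![1, fgnRho1 H; fgnRho1 H, 1]

theorem fgnRho1_sq_lt_one {H : ℝ} (hH : H < 1) : fgnRho1 H ^ 2 < 1 := by
  have hpos : (0 : ℝ) < 2 ^ (2 * H - 1) := by positivity
  have hlt : (2 : ℝ) ^ (2 * H - 1) < 2 ^ (1 : ℝ) :=
    rpow_lt_rpow_of_exponent_lt one_lt_two (by linarith)
  rw [rpow_one] at hlt
  unfold fgnRho1
  nlinarith

theorem fgnRho1_eq_zero_iff {H : ℝ} : fgnRho1 H = 0 ↔ H = 1 / 2 := by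
  rw [fgnRho1, sub_eq_zero, ← rpow_zero (2 : ℝ), rpow_right_inj two_pos (by norm_num)]
  constructor <;> intro h <;> linarith

theorem fgnRho2_half : fgnRho2 (1 / 2) = 0 := by
  norm_num [fgnRho2]

theorem det_fgnCov2_sub_det_fgnCov3 (H : ℝ) :
    (fgnCov2 H).det - (fgnCov3 H).det =
      (1 - fgnRho1 H ^ 2) * fgnRho2 H ^ 2 + fgnRho1 H ^ 2 * (1 - fgnRho2 H) ^ 2 := by
  simp only [fgnCov2, fgnCov3, det_fin_two_of, det_fin_three, of_apply, cons_val]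
  ring

/-- For all `H ∈ (0,1)`:
`det Σ_2(H) − det Σ_3(H) = (ρ_1 − ρ_2)² + 2ρ_1ρ_2(1 − ρ_1) ≥ 0`,
with equality exactly for `H = 1/2`. -/
theorem fgn_det_cov2_ge_det_cov3 (H : ℝ) (hH : H ∈ Set.Ioo (0 : ℝ) 1) :
    (fgnCov2 H).det - (fgnCov3 H).det =
      (fgnRho1 H - fgnRho2 H) ^ 2 + 2 * fgnRho1 H * fgnRho2 H * (1 - fgnRho1 H) ∧
    0 ≤ (fgnCov2 H).det - (fgnCov3 H).det ∧
    ((fgnCov2 H).det = (fgnCov3 H).det ↔ H = 1/2) := by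
  have ha : 0 < 1 - fgnRho1 H ^ 2 := sub_pos.2 (fgnRho1_sq_lt_one hH.2)
  refine ⟨?_, ?_, ?_⟩
  · rw [det_fgnCov2_sub_det_fgnCov3]
    ring
  · rw [det_fgnCov2_sub_det_fgnCov3]
    positivity
  · rw [← sub_eq_zero, det_fgnCov2_sub_det_fgnCov3]
    constructor
    · intro h
      rw [add_eq_zero_iff_of_nonneg (by positivity) (by positivity)] at h
      have hb : fgnRho2 H = 0 := by simpa [ha.ne'] using h.1
      exact fgnRho1_eq_zero_iff.1 (by simpa [hb] using h.2)
    · rintro rfl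
      rw [fgnRho1_eq_zero_iff.2 rfl, fgnRho2_half]
      ring
end
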